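/- arXiv:1106.3948 — 2 statements merged into one kernel-verified Lean document; each statement's English description precedes it below -/
import Mathlib

section
/- (Second Rogers–Ramanujan identity.) For every complex number q with |q| < 1: ∑_{m∈ℤ} (−1)^m q^{(5m^2+3m)/2} = (q;q)_∞ · ∑_{n=0}^∞ q^{n^2+n} / (q;q)_n. -/
open Filter Topology Finset

/-- The finite q-Pochhammer symbol `(q;q)_n`. -/
def qFactorial {K : Type*} [Field K] (q : K) (n : ℕ) : K :=
  ∏ j ∈ range n, (1 - q ^ (j + 1))

section Finite

variable {K : Type*} [Field K] {q : K}

@[simp]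
lemma qFactorial_zero : qFactorial q 0 = 1 := by simp [qFactorial]

lemma qFactorial_succ (n : ℕ) :
    qFactorial q (n + 1) = qFactorial q n * (1 - q ^ (n + 1)) :=
  prod_range_succ _ _

lemma qFactorial_ne_zero (h : ∀ n : ℕ, 1 - q ^ (n + 1) ≠ 0) (n : ℕ) : qFactorial q n ≠ 0 :=
  prod_ne_zero_iff.mpr fun j _ => h j

/-- A limiting case of the q-Vandermonde summation. -/
lemma sum_pow_div_qFactorial (h : ∀ n : ℕ, 1 - q ^ (n + 1) ≠ 0) (N m : ℕ) :
    ∑ k ∈ range (N + 1),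
        q ^ (k * (k + m)) / (qFactorial q k * qFactorial q (N - k) * qFactorial q (k + m)) =
      1 / (qFactorial q N * qFactorial q (N + m)) := by
  have hP := qFactorial_ne_zero h
  induction N generalizing m with
  | zero => simp
  | succ N ih =>
    have split : ∀ k ∈ range (N + 2), (1 - q ^ (N + 1)) *
        (q ^ (k * (k + m)) /
          (qFactorial q k * qFactorial q (N + 1 - k) * qFactorial q (k + m))) =
        q ^ (k * (k + m)) * q ^ k * (1 - q ^ (N + 1 - k)) /
          (qFactorial q k * qFactorial q (N + 1 - k) * qFactorial q (k + m)) +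
        q ^ (k * (k + m)) * (1 - q ^ k) /
          (qFactorial q k * qFactorial q (N + 1 - k) * qFactorial q (k + m)) := by
      intro k hk
      have hk' : k + (N + 1 - k) = N + 1 := by have := mem_range.mp hk; omega
      rw [← add_div, mul_div_assoc']
      congr 1
      rw [← hk', pow_add, Nat.add_sub_cancel_left]
      ring
    apply mul_left_cancel₀ (h N)
    rw [mul_sum, sum_congr rfl split, sum_add_distrib, sum_range_succ,
      sum_range_succ' (fun k => q ^ (k * (k + m)) * (1 - q ^ k) / _)]
    simp only [Nat.sub_self, pow_zero, sub_self, mul_zero, zero_div, add_zero]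
    rw [← sum_add_distrib]
    have step : ∀ k ∈ range (N + 1),
        q ^ (k * (k + m)) * q ^ k * (1 - q ^ (N + 1 - k)) /
          (qFactorial q k * qFactorial q (N + 1 - k) * qFactorial q (k + m)) +
        q ^ ((k + 1) * (k + 1 + m)) * (1 - q ^ (k + 1)) /
          (qFactorial q (k + 1) * qFactorial q (N + 1 - (k + 1)) * qFactorial q (k + 1 + m)) =
        q ^ (k * (k + (m + 1))) /
          (qFactorial q k * qFactorial q (N - k) * qFactorial q (k + (m + 1))) := by
      intro k hk
      have hk' : N + 1 - k = N - k + 1 := by have := mem_range.mp hk; omega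
      rw [hk', Nat.add_sub_add_right, show k + 1 + m = k + m + 1 by ring,
        show k + (m + 1) = k + m + 1 by ring, qFactorial_succ (N - k), qFactorial_succ k,
        qFactorial_succ (k + m)]
      have h1 := h k
      have h2 := h (N - k)
      have h3 := h (k + m)
      have h4 := hP k
      have h5 := hP (N - k)
      have h6 := hP (k + m)
      field_simp
      ring
    rw [sum_congr rfl step, ih, show N + 1 + m = N + (m + 1) by ring, qFactorial_succ]
    have h1 := h N
    have h2 := hP N
    have h3 := hP (N + (m + 1))
    field_simp

/-- The numerators of the Bailey pair relative to `a = q` attached to `β_n = 1 / (q;q)_n`. -/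
def baileyNumerator (q : K) (r : ℕ) : K :=
  (-1) ^ r * q ^ (r ^ 2 + r + r.choose 2) * (1 - q ^ (2 * r + 1))

lemma sum_range_baileyNumerator_sub (h : ∀ n : ℕ, 1 - q ^ (n + 1) ≠ 0) (n J : ℕ)
    (hJ : J ≤ n + 1) :
    ∑ j ∈ range J,
      ((1 - q ^ (n + 1)) * (baileyNumerator q j /
          (qFactorial q (n + 1 - j) * qFactorial q (n + 1 + j + 1))) -
        baileyNumerator q j / (qFactorial q (n - j) * qFactorial q (n + j + 1))) =
      -((-1) ^ J * q ^ (n + 1) * q ^ (J ^ 2 + J.choose 2) * (1 - q ^ J)) /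
        (qFactorial q (n + 1 - J) * qFactorial q (n + 1 + J)) := by
  have hP := qFactorial_ne_zero h
  induction J with
  | zero => simp
  | succ J ih =>
    obtain ⟨k, rfl⟩ := Nat.exists_eq_add_of_le (show J ≤ n by omega)
    rw [sum_range_succ, ih (by omega), show J + k + 1 - J = k + 1 by omega,
      show J + k - J = k by omega, show J + k + 1 - (J + 1) = k by omega,
      show J + k + 1 + (J + 1) = 2 * J + k + 2 by ring,
      show J + k + 1 + J + 1 = 2 * J + k + 2 by ring,
      show J + k + J + 1 = 2 * J + k + 1 by ring,
      show J + k + 1 + J = 2 * J + k + 1 by ring,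
      show (J + 1).choose 2 = J + J.choose 2 by simp [Nat.choose_succ_succ' J 1],
      qFactorial_succ k, qFactorial_succ (2 * J + k + 1), baileyNumerator]
    have h1 := h k
    have h2 := h (2 * J + k + 1)
    have h3 := hP k
    have h4 := hP (2 * J + k + 1)
    field_simp
    ring

/-- The Bailey pair relation for `β_n = 1 / (q;q)_n`. -/
lemma sum_baileyNumerator_div (h : ∀ n : ℕ, 1 - q ^ (n + 1) ≠ 0) (n : ℕ) :
    ∑ j ∈ range (n + 1),
      baileyNumerator q j / (qFactorial q (n - j) * qFactorial q (n + j + 1)) =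
      1 / qFactorial q n := by
  have hP := qFactorial_ne_zero h
  induction n with
  | zero =>
    have h0 := h 0
    simp only [zero_add, pow_one] at h0
    simp [baileyNumerator, qFactorial, h0]
  | succ n ih =>
    have key := sum_range_baileyNumerator_sub h n (n + 1) le_rfl
    rw [sum_sub_distrib, ih, ← mul_sum, sub_eq_iff_eq_add] at key
    apply mul_left_cancel₀ (h n)
    rw [sum_range_succ, mul_add, key, Nat.sub_self, qFactorial_succ (n + 1 + (n + 1)),
      qFactorial_succ n, baileyNumerator]
    have h1 := h n
    have h2 := h (n + 1 + (n + 1))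
    have h3 := hP n
    have h4 := hP (n + 1 + (n + 1))
    rw [show 2 * (n + 1) + 1 = n + 1 + (n + 1) + 1 by ring, qFactorial_zero]
    field_simp
    ring

/-- A finite form of the second Rogers–Ramanujan identity. -/
lemma sum_rogersRamanujan_finite (h : ∀ n : ℕ, 1 - q ^ (n + 1) ≠ 0) (N : ℕ) :
    ∑ n ∈ range (N + 1), q ^ (n ^ 2 + n) / qFactorial q n * (1 / qFactorial q (N - n)) =
      ∑ r ∈ range (N + 1), q ^ (r ^ 2 + r) * baileyNumerator q r *
        (1 / (qFactorial q (N - r) * qFactorial q (N + r + 1))) := by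
  have expand : ∀ n ∈ range (N + 1),
      q ^ (n ^ 2 + n) / qFactorial q n * (1 / qFactorial q (N - n)) =
      ∑ r ∈ range (n + 1), q ^ (n ^ 2 + n) * (1 / qFactorial q (N - n)) *
        (baileyNumerator q r / (qFactorial q (n - r) * qFactorial q (n + r + 1))) := by
    intro n _
    rw [← mul_sum, sum_baileyNumerator_div h]
    ring
  rw [sum_congr rfl expand, sum_comm' (t' := range (N + 1)) (s' := fun r => Ico r (N + 1))
    (by intro n r; simp only [mem_range, mem_Ico]; omega)]
  refine sum_congr rfl fun r hr => ?_
  obtain ⟨M, rfl⟩ := Nat.exists_eq_add_of_le (Nat.lt_succ_iff.mp (mem_range.mp hr))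
  rw [sum_Ico_eq_sum_range, show r + M + 1 - r = M + 1 by omega, Nat.add_sub_cancel_left,
    show r + M + r + 1 = M + (2 * r + 1) by ring, ← sum_pow_div_qFactorial h, mul_sum]
  refine sum_congr rfl fun k _ => ?_
  rw [Nat.add_sub_add_left, Nat.add_sub_cancel_left,
    show r + k + r + 1 = k + (2 * r + 1) by ring,
    show (r + k) ^ 2 + (r + k) = r ^ 2 + r + k * (k + (2 * r + 1)) by ring, pow_add q (r ^ 2 + r)]
  simp only [div_eq_mul_inv, mul_inv]
  ring

end Finite

/-- Tannery's theorem for weighted finite sums. -/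
lemma tendsto_sum_range_mul_of_bounded {c : ℕ → ℂ} (hc : Summable fun n => ‖c n‖)
    {w : ℕ → ℕ → ℂ} {C : ℝ} (hw : ∀ N n, ‖w N n‖ ≤ C) {L : ℂ}
    (hL : ∀ n, Tendsto (fun N => w N n) atTop (𝓝 L)) :
    Tendsto (fun N => ∑ n ∈ range (N + 1), c n * w N n) atTop (𝓝 ((∑' n, c n) * L)) := by
  have hsum : ∀ N, ∑ n ∈ range (N + 1), c n * w N n =
      ∑' n, if n ∈ range (N + 1) then c n * w N n else 0 := by
    intro N
    rw [tsum_eq_sum (s := range (N + 1)) (fun n hn => if_neg hn)]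
    exact sum_congr rfl fun n hn => (if_pos hn).symm
  simp_rw [hsum]
  rw [← tsum_mul_right]
  refine tendsto_tsum_of_dominated_convergence (hc.mul_right C) (fun n => ?_)
    (Eventually.of_forall fun N n => ?_)
  · refine ((hL n).const_mul (c n)).congr' ?_
    filter_upwards [eventually_ge_atTop n] with N hN
    rw [if_pos (by simp only [mem_range]; omega)]
  · split_ifs
    · rw [norm_mul]
      exact mul_le_mul_of_nonneg_left (hw N n) (norm_nonneg _)
    · rw [norm_zero]
      exact mul_nonneg (norm_nonneg _) ((norm_nonneg _).trans (hw N n))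

section Disc

variable {q : ℂ}

lemma one_sub_pow_succ_ne_zero (hq : ‖q‖ < 1) (n : ℕ) : 1 - q ^ (n + 1) ≠ 0 := by
  intro h
  have h1 : ‖q ^ (n + 1)‖ < 1 := by
    rw [norm_pow]
    exact pow_lt_one₀ (norm_nonneg _) hq n.succ_ne_zero
  rw [← sub_eq_zero.mp h, norm_one] at h1
  exact lt_irrefl _ h1

lemma summable_norm_neg_pow_succ (hq : ‖q‖ < 1) : Summable fun n : ℕ => ‖-q ^ (n + 1)‖ := by
  simpa using (summable_nat_add_iff 1).mpr (summable_geometric_of_lt_one (norm_nonneg _) hq)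

lemma tprod_one_sub_pow_succ_ne_zero (hq : ‖q‖ < 1) : ∏' j : ℕ, (1 - q ^ (j + 1)) ≠ 0 := by
  simpa only [sub_eq_add_neg] using tprod_one_add_ne_zero_of_summable
    (f := fun n : ℕ => -q ^ (n + 1))
    (fun n => by simpa only [sub_eq_add_neg] using one_sub_pow_succ_ne_zero hq n)
    (summable_norm_neg_pow_succ hq)

lemma tendsto_one_div_qFactorial (hq : ‖q‖ < 1) :
    Tendsto (fun n => 1 / qFactorial q n) atTop (𝓝 (1 / ∏' j : ℕ, (1 - q ^ (j + 1)))) := by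
  refine Tendsto.div tendsto_const_nhds ?_ (tprod_one_sub_pow_succ_ne_zero hq)
  have hm := multipliable_one_add_of_summable (summable_norm_neg_pow_succ hq)
  simp only [← sub_eq_add_neg] at hm
  exact hm.tendsto_prod_tprod_nat

lemma summable_norm_mul_pow {b : ℕ → ℂ} {e : ℕ → ℕ} {C : ℝ} (hq : ‖q‖ < 1)
    (hb : ∀ n, ‖b n‖ ≤ C) (he : ∀ n, n ≤ e n) : Summable fun n => ‖b n * q ^ e n‖ := by
  refine Summable.of_nonneg_of_le (fun _ => norm_nonneg _) (fun n => ?_)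
    ((summable_geometric_of_lt_one (norm_nonneg q) hq).mul_left C)
  rw [norm_mul, norm_pow]
  exact mul_le_mul (hb n) (pow_le_pow_of_le_one (norm_nonneg _) hq.le (he n))
    (by positivity) ((norm_nonneg _).trans (hb n))

lemma pow_mul_baileyNumerator (r : ℕ) :
    q ^ (r ^ 2 + r) * baileyNumerator q r =
      (-1) ^ r * q ^ (2 * r ^ 2 + 2 * r + r.choose 2) +
        -(-1) ^ r * q ^ (2 * r ^ 2 + 4 * r + 1 + r.choose 2) := by
  rw [baileyNumerator]
  ring

lemma two_mul_choose_two_cast (n : ℕ) : 2 * (n.choose 2 : ℤ) = n ^ 2 - n := by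
  induction n with
  | zero => simp
  | succ n ih =>
    rw [Nat.choose_succ_succ' n 1, Nat.choose_one_right]
    push_cast
    linarith

/-- The theta series is the sum of the weighted Bailey numerators. -/
lemma hasSum_theta (hq : ‖q‖ < 1) :
    HasSum (fun m : ℤ => (-1 : ℂ) ^ m * q ^ ((5 * m ^ 2 + 3 * m) / 2))
      (∑' r : ℕ, q ^ (r ^ 2 + r) * baileyNumerator q r) := by
  have s1 : Summable fun r : ℕ => (-1 : ℂ) ^ r * q ^ (2 * r ^ 2 + 2 * r + r.choose 2) :=
    (summable_norm_mul_pow (C := 1) hq (fun n => by simp) (fun n => by nlinarith)).of_norm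
  have s2 : Summable fun r : ℕ => -(-1 : ℂ) ^ r * q ^ (2 * r ^ 2 + 4 * r + 1 + r.choose 2) :=
    (summable_norm_mul_pow (C := 1) hq (fun n => by simp) (fun n => by nlinarith)).of_norm
  simp_rw [pow_mul_baileyNumerator]
  rw [s1.tsum_add s2]
  refine HasSum.of_nat_of_neg_add_one (s1.hasSum.congr_fun fun n => ?_)
    (s2.hasSum.congr_fun fun n => ?_)
  · have hc := two_mul_choose_two_cast n
    have he : (5 * (n : ℤ) ^ 2 + 3 * n) / 2 =
        ((2 * n ^ 2 + 2 * n + n.choose 2 : ℕ) : ℤ) := by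
      push_cast
      omega
    rw [he, zpow_natCast, zpow_natCast]
  · have hc := two_mul_choose_two_cast n
    have he : (5 * (-((n : ℤ) + 1)) ^ 2 + 3 * (-((n : ℤ) + 1))) / 2 =
        ((2 * n ^ 2 + 4 * n + 1 + n.choose 2 : ℕ) : ℤ) := by
      push_cast
      rw [show 5 * (-((n : ℤ) + 1)) ^ 2 + 3 * (-((n : ℤ) + 1)) = 5 * (n : ℤ) ^ 2 + 7 * n + 2 by
        ring]
      omega
    have hs : (-1 : ℂ) ^ (-((n : ℤ) + 1)) = -(-1) ^ n := by
      rw [zpow_neg, ← inv_zpow, inv_neg_one, zpow_add_one₀ (by norm_num), zpow_natCast, mul_neg_one]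
    rw [he, zpow_natCast, hs]

end Disc

/-- **The second Rogers–Ramanujan identity.** For every complex `q` with `|q| < 1`:
`∑_{m∈ℤ} (−1)^m q^{(5m²+3m)/2} = (q;q)_∞ · ∑_{n=0}^∞ q^{n²+n} / (q;q)_n`. -/
theorem rogers_ramanujan_second (q : ℂ) (hq : ‖q‖ < 1) :
    ∑' m : ℤ, (-1 : ℂ) ^ m * q ^ ((5 * m ^ 2 + 3 * m) / 2) =
      (∏' j : ℕ, (1 - q ^ (j + 1))) *
        ∑' n : ℕ, q ^ (n ^ 2 + n) / ∏ j ∈ Finset.range n, (1 - q ^ (j + 1)) := by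
  have hne := one_sub_pow_succ_ne_zero hq
  have hPinf := tprod_one_sub_pow_succ_ne_zero hq
  have hlim := tendsto_one_div_qFactorial hq
  obtain ⟨C, hC⟩ : ∃ C, ∀ n, ‖1 / qFactorial q n‖ ≤ C := by
    obtain ⟨C, hC⟩ := hlim.norm.bddAbove_range
    exact ⟨C, fun n => hC ⟨n, rfl⟩⟩
  have hC0 : 0 ≤ C := (norm_nonneg _).trans (hC 0)
  have sumL : Summable fun n : ℕ => ‖q ^ (n ^ 2 + n) / qFactorial q n‖ := by
    simpa only [one_div_mul_eq_div] using
      summable_norm_mul_pow (e := fun n => n ^ 2 + n) hq hC (fun n => by simp)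
  have sumR : Summable fun r : ℕ => ‖q ^ (r ^ 2 + r) * baileyNumerator q r‖ := by
    simp_rw [pow_mul_baileyNumerator]
    refine Summable.of_nonneg_of_le (fun _ => norm_nonneg _) (fun r => norm_add_le _ _) ?_
    exact (summable_norm_mul_pow (C := 1) hq (fun n => by simp) (fun n => by nlinarith)).add
      (summable_norm_mul_pow (C := 1) hq (fun n => by simp) (fun n => by nlinarith))
  have limL := tendsto_sum_range_mul_of_bounded sumL
    (w := fun N n => 1 / qFactorial q (N - n)) (fun N n => hC (N - n))
    (fun n => hlim.comp (tendsto_sub_atTop_nat n))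
  have limR := tendsto_sum_range_mul_of_bounded sumR
    (w := fun N r => 1 / (qFactorial q (N - r) * qFactorial q (N + r + 1))) (C := C * C)
    (fun N r => by
      rw [← one_div_mul_one_div, norm_mul]
      exact mul_le_mul (hC _) (hC _) (norm_nonneg _) hC0)
    (fun r => by
      simp_rw [← one_div_mul_one_div]
      exact (hlim.comp (tendsto_sub_atTop_nat r)).mul
        (hlim.comp (tendsto_add_atTop_nat (r + 1))))
  simp_rw [sum_rogersRamanujan_finite hne] at limL
  have heq := tendsto_nhds_unique limL limR
  rw [(hasSum_theta hq).tsum_eq]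
  change _ = _ * ∑' n : ℕ, q ^ (n ^ 2 + n) / qFactorial q n
  field_simp at heq
  rw [← heq, mul_comm]
end

section
/- For every integer N ≥ 1, the following congruence holds in the formal power series ring ℚ⟦q⟧: ∑_{j=0}^{N−1} ∑_{l=0}^{j} [ (q;q)_{N−1−l} (q;q)_j (q;q)_{N−1} / ( (q;q)_{N−1−j} (q;q)_l (q;q)_{j−l} (q;q)_{N−1−j+l} ) ] · q^{2N(N−1) + j + j^2 − 3jN + l(N−j)} ≡ ((q;q)_{N−1})^2 · ∑_{l=0}^{N−1} q^l / ((q;q)_l)^2 (mod q^N). -/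
open PowerSeries

/-- The finite q-Pochhammer symbol `(q;q)_n = ∏_{j=1}^n (1 − q^j)` as a formal
power series in `q = X` over `ℚ`.  It has constant term `1`, hence is invertible. -/
noncomputable def qPoch (n : ℕ) : PowerSeries ℚ :=
  ∏ j ∈ Finset.range n, (1 - (PowerSeries.X : PowerSeries ℚ) ^ (j + 1))

theorem constantCoeff_qPoch (n : ℕ) : constantCoeff (qPoch n) = 1 := by
  simp [qPoch, map_prod]

theorem qPoch_mul_inv (n : ℕ) : qPoch n * (qPoch n)⁻¹ = 1 :=
  PowerSeries.mul_inv_cancel _ (by simp [constantCoeff_qPoch])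

/-- With `j = M - i`, the exponent of the state sum for `N = M + 1`. -/
theorem stateSum_exponent_eq (i j l : ℕ) :
    2 * (j + i + 1) * (j + i) + j + j ^ 2 + l * (i + 1) - 3 * j * (j + i + 1) =
      i * (j + i + 1) + i + i ^ 2 + l * (i + 1) := by
  apply Nat.sub_eq_of_eq_add
  ring

/-- For every integer `N ≥ 1`, in `ℚ⟦q⟧`:
`∑_{j=0}^{N−1} ∑_{l=0}^{j} [(q;q)_{N−1−l}(q;q)_j(q;q)_{N−1} /
   ((q;q)_{N−1−j}(q;q)_l(q;q)_{j−l}(q;q)_{N−1−j+l})] · q^{2N(N−1)+j+j²−3jN+l(N−j)}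
 ≡ ((q;q)_{N−1})² · ∑_{l=0}^{N−1} q^l/((q;q)_l)²  (mod q^N)`.
This is the computation of the tail of the colored Jones polynomial of the
`(2,−4)`-torus link from its `R`-matrix state sum. -/
theorem torusLink_state_sum_tail (N : ℕ) (hN : 1 ≤ N) :
    (PowerSeries.X : PowerSeries ℚ) ^ N ∣
      (∑ j ∈ Finset.range N, ∑ l ∈ Finset.range (j + 1),
          qPoch (N - 1 - l) * qPoch j * qPoch (N - 1) *
            (qPoch (N - 1 - j) * qPoch l * qPoch (j - l) * qPoch (N - 1 - j + l))⁻¹ *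
              (PowerSeries.X : PowerSeries ℚ) ^
                (2 * N * (N - 1) + j + j ^ 2 + l * (N - j) - 3 * j * N)) -
        (qPoch (N - 1)) ^ 2 *
          ∑ l ∈ Finset.range N,
            (PowerSeries.X : PowerSeries ℚ) ^ l * ((qPoch l) ^ 2)⁻¹ := by
  obtain ⟨M, rfl⟩ : ∃ M, N = M + 1 := ⟨N - 1, by omega⟩
  simp only [Nat.add_sub_cancel]
  rw [Finset.sum_range_succ, add_sub_assoc]
  refine dvd_add (Finset.dvd_sum fun j hj => Finset.dvd_sum fun l _ => ?_) ?_
  · refine Dvd.dvd.mul_left (pow_dvd_pow _ ?_) _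
    obtain ⟨i, rfl⟩ := Nat.exists_eq_add_of_lt (Finset.mem_range.mp hj)
    have h : j + i + 1 + 1 - j = i + 1 + 1 := by omega
    rw [h]
    have e := stateSum_exponent_eq (i + 1) j l
    simp only [← add_assoc] at e
    rw [e]
    nlinarith [Nat.zero_le (i * (j + i + 1 + 1)), Nat.zero_le (l * (i + 1 + 1))]
  · convert dvd_zero _
    rw [sub_eq_zero, Finset.mul_sum]
    refine Finset.sum_congr rfl fun l _ => ?_
    have h : M + 1 - M = 0 + 1 := by omega
    have e := stateSum_exponent_eq 0 M l
    simp only [add_zero] at e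
    rw [h, e]
    have h0 : qPoch 0 = 1 := by simp [qPoch]
    simp only [Nat.sub_self, h0, pow_two, PowerSeries.mul_inv_rev]
    simp only [zero_add, zero_mul, mul_one, inv_one]
    linear_combination (qPoch M * qPoch M * (qPoch l)⁻¹ * (qPoch l)⁻¹ *
      (X : PowerSeries ℚ) ^ l) * qPoch_mul_inv (M - l)
end
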